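/- arXiv:1307.8386 — 2 statements merged into one kernel-verified Lean document; each statement's English description precedes it below -/
import Mathlib

section
/- Suppose q > 3, Δ = 4ab − c² = 0 and (a,b,c) ≠ (0,0,0) (so Q is a quadric cone). Then the number of points of PG(3,q²) lying on both H and Q is one of the eight values q³−q²+1, q³−q²+q+1, q³−q+1, q³+1, q³+q+1, q³+q²−q+1, q³+q²+1, q³+2q²−q+1. -/
/-- The Hermitian surface `H` of `PG(3,q²)`. -/
def hermPt (q : ℕ) {F : Type} [Field F] (v : Fin 4 → F) : Prop :=
  (v 0) ^ q * v 3 + v 0 * (v 3) ^ q = (v 1) ^ (q + 1) + (v 2) ^ (q + 1)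

/-- The quadric `Q`. -/
def quadPt {F : Type} [Field F] (a b c d e f : F) (v : Fin 4 → F) : Prop :=
  v 0 * v 3 =
    a * (v 1) ^ 2 + b * (v 2) ^ 2 + c * (v 1) * (v 2) +
      d * (v 1) * (v 0) + e * (v 2) * (v 0) + f * (v 0) ^ 2

/-- Fibrewise count of the pairs satisfying a binary relation. -/
lemma natCard_pairs {α β : Type*} [Fintype α] [Finite β] (R : α → β → Prop) :
    Nat.card {p : α × β // R p.1 p.2} = ∑ x, Nat.card {y // R x y} := by
  rw [← Nat.card_sigma]
  exact Nat.card_congr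
    { toFun := fun p => ⟨p.1.1, p.1.2, p.2⟩
      invFun := fun p => ⟨(p.1, p.2.1), p.2.2⟩
      left_inv := fun _ => rfl
      right_inv := fun _ => rfl }

section Conics

variable {K : Type*} [Field K] [Fintype K] [DecidableEq K]

lemma natCard_sqrts (hK : ringChar K ≠ 2) (a : K) :
    (Nat.card {x : K // x ^ 2 = a} : ℤ) = quadraticChar K a + 1 := by
  rw [← quadraticChar_card_sqrts hK a, Set.toFinset_card, Nat.card_eq_fintype_card]
  rfl

lemma natCard_sq_eq (hK : ringChar K ≠ 2) (h : K → K) :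
    (Nat.card {p : K × K // p.1 ^ 2 = h p.2} : ℤ)
      = Fintype.card K + ∑ y, quadraticChar K (h y) := by
  have e : Nat.card {p : K × K // p.1 ^ 2 = h p.2} = Nat.card {p : K × K // p.2 ^ 2 = h p.1} :=
    Nat.card_congr ((Equiv.prodComm K K).subtypeEquiv fun _ => Iff.rfl)
  rw [e, natCard_pairs fun y t => t ^ 2 = h y]
  push_cast
  simp only [natCard_sqrts hK, Finset.sum_add_distrib]
  simp [add_comm]

lemma natCard_mul_eq (c : K) :
    (Nat.card {p : K × K // p.1 * p.2 = c} : ℤ)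
      = if c = 0 then 2 * (Fintype.card K : ℤ) - 1 else (Fintype.card K : ℤ) - 1 := by
  have hne : ∀ u : K, u ≠ 0 → Nat.card {v // u * v = c} = 1 := fun u hu => by
    rw [Nat.card_eq_one_iff_unique]
    exact ⟨⟨fun a b => Subtype.ext (mul_left_cancel₀ hu (a.2.trans b.2.symm))⟩,
      ⟨⟨u⁻¹ * c, by field_simp⟩⟩⟩
  rw [natCard_pairs fun u v => u * v = c, ← Finset.add_sum_erase _ _ (Finset.mem_univ (0 : K)),
    Finset.sum_congr rfl fun u hu => hne u (Finset.ne_of_mem_erase hu)]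
  have h1 : 1 ≤ Fintype.card K := Fintype.card_pos
  simp only [Finset.sum_const, Finset.card_erase_of_mem (Finset.mem_univ (0 : K)),
    Finset.card_univ, zero_mul]
  split_ifs with hc
  · subst hc
    simp [Nat.cast_sub h1]
    ring
  · have : IsEmpty {v : K // 0 = c} := ⟨fun v => hc v.2.symm⟩
    simp [Nat.cast_sub h1]

lemma sum_quadraticChar_sq_add (hK : ringChar K ≠ 2) (c : K) :
    ∑ y : K, quadraticChar K (y ^ 2 + c)
      = if c = 0 then (Fintype.card K : ℤ) - 1 else -1 := by
  have h2 : (2 : K) ≠ 0 := Ring.two_ne_zero hK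
  have e : Nat.card {p : K × K // p.1 ^ 2 = p.2 ^ 2 + c} = Nat.card {p : K × K // p.1 * p.2 = c} :=
    Nat.card_congr (Equiv.subtypeEquiv
      { toFun := fun p => (p.1 - p.2, p.1 + p.2)
        invFun := fun p => ((p.1 + p.2) / 2, (p.2 - p.1) / 2)
        left_inv := fun p => by ext <;> simp <;> field_simp <;> ring
        right_inv := fun p => by ext <;> simp <;> field_simp <;> ring }
      fun p => by
        constructor <;> intro h <;> simp only [Equiv.coe_fn_mk] at * <;> linear_combination h)
  have h := natCard_sq_eq hK fun y : K => y ^ 2 + c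
  rw [e, natCard_mul_eq] at h
  split_ifs at h ⊢ <;> linarith

lemma sum_quadraticChar_quadratic (hK : ringChar K ≠ 2) {A : K} (hA : A ≠ 0) (B C : K) :
    ∑ y : K, quadraticChar K (A * y ^ 2 + B * y + C)
      = quadraticChar K A * if 4 * A * C = B ^ 2 then (Fintype.card K : ℤ) - 1 else -1 := by
  have h2 : (2 : K) ≠ 0 := Ring.two_ne_zero hK
  have h4 : (4 : K) ≠ 0 := by
    rw [show (4 : K) = 2 * 2 by norm_num]; exact mul_ne_zero h2 h2
  have hc : ((C / A - (B / (2 * A)) ^ 2 : K) = 0) ↔ 4 * A * C = B ^ 2 := by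
    have : (C / A - (B / (2 * A)) ^ 2 : K) = (4 * A * C - B ^ 2) / (4 * A ^ 2) := by
      field_simp; ring
    rw [this, div_eq_zero_iff, sub_eq_zero]
    simp [hA, h4]
  rw [← if_congr hc rfl rfl, ← sum_quadraticChar_sq_add hK, Finset.mul_sum,
    ← Equiv.sum_comp (Equiv.subRight (B / (2 * A)))]
  refine Finset.sum_congr rfl fun y _ => ?_
  rw [← map_mul]
  congr 1
  simp only [Equiv.subRight_apply]
  field_simp
  ring

lemma natCard_normForm (hK : ringChar K ≠ 2) {A : K} (hA : ¬ IsSquare A) (c : K) :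
    Nat.card {p : K × K // p.1 ^ 2 - A * p.2 ^ 2 = c}
      = if c = 0 then 1 else Fintype.card K + 1 := by
  have hA0 : A ≠ 0 := fun h => hA (h ▸ IsSquare.zero)
  have h4 : (4 : K) ≠ 0 := by
    rw [show (4 : K) = 2 * 2 by norm_num]
    exact mul_ne_zero (Ring.two_ne_zero hK) (Ring.two_ne_zero hK)
  have e : Nat.card {p : K × K // p.1 ^ 2 - A * p.2 ^ 2 = c}
      = Nat.card {p : K × K // p.1 ^ 2 = A * p.2 ^ 2 + 0 * p.2 + c} :=
    Nat.card_congr (Equiv.subtypeEquivRight fun p => by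
      rw [sub_eq_iff_eq_add, zero_mul, add_zero, add_comm])
  have h := natCard_sq_eq hK fun y : K => A * y ^ 2 + 0 * y + c
  rw [sum_quadraticChar_quadratic hK hA0, quadraticChar_neg_one_iff_not_isSquare.mpr hA, ← e] at h
  have hc : 4 * A * c = 0 ^ 2 ↔ c = 0 := by simp [hA0, h4]
  rw [if_congr hc rfl rfl] at h
  split_ifs at h ⊢ <;> lia

/-- The number of affine points of a (possibly degenerate) conic over a field of `q` elements. -/
def IsConicCount (q m : ℕ) : Prop :=
  m = 0 ∨ m = 1 ∨ m + 1 = q ∨ m = q ∨ m = q + 1 ∨ m + 1 = 2 * q ∨ m = 2 * q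

lemma isConicCount_sq_eq (hK : ringChar K ≠ 2) (A B C : K) :
    IsConicCount (Fintype.card K)
      (Nat.card {p : K × K // p.1 ^ 2 = A * p.2 ^ 2 + B * p.2 + C}) := by
  have h := natCard_sq_eq hK fun y : K => A * y ^ 2 + B * y + C
  unfold IsConicCount
  by_cases hA : A = 0
  · subst hA
    by_cases hB : B = 0
    · subst hB
      simp only [zero_mul, zero_add, Finset.sum_const, Finset.card_univ, nsmul_eq_mul] at h ⊢
      rcases eq_or_ne C 0 with rfl | hC
      · simp at h ⊢; lia
      · rcases quadraticChar_dichotomy hC with h' | h' <;> rw [h'] at h <;> lia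
    · have : ∑ y : K, quadraticChar K (0 * y ^ 2 + B * y + C) = 0 := by
        rw [← quadraticChar_sum_zero hK]
        refine Fintype.sum_equiv ((Equiv.mulLeft₀ B hB).trans (Equiv.addRight C)) _ _ fun y => ?_
        simp
      rw [this] at h
      lia
  · rw [sum_quadraticChar_quadratic hK hA] at h
    rcases quadraticChar_dichotomy hA with h' | h' <;> rw [h'] at h <;> split_ifs at h <;> lia

lemma isConicCount_of_left (hK : ringChar K ≠ 2) {α : K} (hα : α ≠ 0) (β γ δ ε φ : K) :
    IsConicCount (Fintype.card K) (Nat.card {p : K × K //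
      α * p.1 ^ 2 + β * p.1 * p.2 + γ * p.2 ^ 2 + δ * p.1 + ε * p.2 + φ = 0}) := by
  have h2 : (2 : K) ≠ 0 := Ring.two_ne_zero hK
  have h4 : (4 : K) ≠ 0 := by
    rw [show (4 : K) = 2 * 2 by norm_num]; exact mul_ne_zero h2 h2
  have e := Nat.card_congr (Equiv.subtypeEquiv
    (p := fun p : K × K =>
      α * p.1 ^ 2 + β * p.1 * p.2 + γ * p.2 ^ 2 + δ * p.1 + ε * p.2 + φ = 0)
    (q := fun p : K × K => p.1 ^ 2 = (β ^ 2 - 4 * α * γ) * p.2 ^ 2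
      + (2 * β * δ - 4 * α * ε) * p.2 + (δ ^ 2 - 4 * α * φ))
    { toFun := fun p => (2 * α * p.1 + β * p.2 + δ, p.2)
      invFun := fun p => ((p.1 - β * p.2 - δ) / (2 * α), p.2)
      left_inv := fun p => by ext <;> simp; field_simp; ring
      right_inv := fun p => by ext <;> simp; field_simp; ring }
    fun p => by
      simp only [Equiv.coe_fn_mk]
      constructor
      · intro h; linear_combination 4 * α * h
      · intro h
        apply mul_left_cancel₀ (mul_ne_zero h4 hα)
        linear_combination h)
  rw [e]
  exact isConicCount_sq_eq hK _ _ _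

lemma isConicCount_natCard (hK : ringChar K ≠ 2) {α β γ : K} (h : ¬ (α = 0 ∧ β = 0 ∧ γ = 0))
    (δ ε φ : K) :
    IsConicCount (Fintype.card K) (Nat.card {p : K × K //
      α * p.1 ^ 2 + β * p.1 * p.2 + γ * p.2 ^ 2 + δ * p.1 + ε * p.2 + φ = 0}) := by
  by_cases hα : α = 0
  · by_cases hγ : γ = 0
    · have hβ : β ≠ 0 := fun hβ => h ⟨hα, hβ, hγ⟩
      subst hα hγ
      have e := Nat.card_congr (Equiv.subtypeEquiv
        (p := fun p : K × K =>
          0 * p.1 ^ 2 + β * p.1 * p.2 + 0 * p.2 ^ 2 + δ * p.1 + ε * p.2 + φ = 0)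
        (q := fun p : K × K => p.1 * p.2 = δ * ε - β * φ)
        { toFun := fun p => (β * p.1 + ε, β * p.2 + δ)
          invFun := fun p => ((p.1 - ε) / β, (p.2 - δ) / β)
          left_inv := fun p => by ext <;> simp <;> field_simp
          right_inv := fun p => by ext <;> simp <;> field_simp <;> ring }
        fun p => by
          simp only [Equiv.coe_fn_mk]
          constructor
          · intro h; linear_combination β * h
          · intro h
            apply mul_left_cancel₀ hβ
            linear_combination h)
      have h := natCard_mul_eq (δ * ε - β * φ)
      rw [e]
      unfold IsConicCount
      split_ifs at h <;> lia
    · have e := Nat.card_congr (Equiv.subtypeEquiv (Equiv.prodComm K K)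
        (p := fun p : K × K =>
          α * p.1 ^ 2 + β * p.1 * p.2 + γ * p.2 ^ 2 + δ * p.1 + ε * p.2 + φ = 0)
        (q := fun p : K × K =>
          γ * p.1 ^ 2 + β * p.1 * p.2 + α * p.2 ^ 2 + ε * p.1 + δ * p.2 + φ = 0)
        fun p => by
          simp only [Equiv.prodComm_apply, Prod.fst_swap, Prod.snd_swap]
          constructor <;> intro h <;> linear_combination h)
      rw [e]
      exact isConicCount_of_left hK hγ _ _ _ _ _
  · exact isConicCount_of_left hK hα _ _ _ _ _

end Conics

section QuadraticExtension

variable {K F : Type*} [Field K] [Field F]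

/-- `F` is the quadratic extension `K(θ)`, where `θ ^ 2 = A` is a nonsquare of `K`, and `σ` is its
conjugation. -/
structure IsQuadraticConj (i : K →+* F) (σ : F →+* F) (A : K) (θ : F) : Prop where
  not_isSquare : ¬ IsSquare A
  sq_eq : θ ^ 2 = i A
  map_base : ∀ k, σ (i k) = i k
  map_root : σ θ = -θ
  bijective : Function.Bijective fun p : K × K => i p.1 + i p.2 * θ

namespace IsQuadraticConj

variable {i : K →+* F} {σ : F →+* F} {A : K} {θ : F}

lemma exists_coords (h : IsQuadraticConj i σ A θ) (x : F) : ∃ X Y : K, x = i X + i Y * θ := by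
  obtain ⟨p, hp⟩ := h.bijective.2 x
  exact ⟨p.1, p.2, hp.symm⟩

lemma map_coords (h : IsQuadraticConj i σ A θ) (X Y : K) :
    σ (i X + i Y * θ) = i X - i Y * θ := by
  rw [map_add, map_mul, h.map_base, h.map_base, h.map_root]
  ring

lemma involutive (h : IsQuadraticConj i σ A θ) (x : F) : σ (σ x) = x := by
  obtain ⟨X, Y, rfl⟩ := h.exists_coords x
  rw [h.map_coords, map_sub, map_mul, h.map_base, h.map_base, h.map_root]
  ring

lemma root_ne_zero (h : IsQuadraticConj i σ A θ) : θ ≠ 0 := by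
  rintro rfl
  have : A = 0 := i.injective (by rw [← h.sq_eq]; simp)
  exact h.not_isSquare (this ▸ IsSquare.zero)

lemma exists_base (h : IsQuadraticConj i σ A θ) (h2 : (2 : K) ≠ 0) {x : F} (hx : σ x = x) :
    ∃ k, x = i k := by
  obtain ⟨X, Y, rfl⟩ := h.exists_coords x
  rw [h.map_coords] at hx
  have h2' : (2 : F) ≠ 0 := by
    rw [← map_ofNat i 2]
    exact (map_ne_zero i).2 h2
  have hY : i Y = 0 := by
    refine (mul_eq_zero.1 (?_ : 2 * θ * i Y = 0)).resolve_left (mul_ne_zero h2' h.root_ne_zero)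
    linear_combination -hx
  exact ⟨X, by rw [hY]; ring⟩

lemma natCard_coords (h : IsQuadraticConj i σ A θ) (R : F → Prop) (S : K × K → Prop)
    (hRS : ∀ X Y, S (X, Y) ↔ R (i X + i Y * θ)) : Nat.card {x // R x} = Nat.card {p // S p} :=
  (Nat.card_congr ((Equiv.ofBijective _ h.bijective).subtypeEquiv fun p => hRS p.1 p.2)).symm

lemma natCard_trace_fibre (h : IsQuadraticConj i σ A θ) (h2 : (2 : K) ≠ 0) {w c : F}
    (hw : w ≠ 0) (hc : σ c = c) : Nat.card {y // w * y + σ (w * y) = c} = Nat.card K := by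
  obtain ⟨k, rfl⟩ := h.exists_base h2 hc
  have e : Nat.card {y // w * y + σ (w * y) = i k} = Nat.card {y // y + σ y = i k} :=
    Nat.card_congr ((Equiv.mulLeft₀ w hw).subtypeEquiv fun _ => Iff.rfl)
  rw [e, h.natCard_coords _ fun p => 2 * p.1 = k]
  · refine Nat.card_congr
      { toFun := fun p => p.1.2
        invFun := fun Y => ⟨(k / 2, Y), by field_simp⟩
        left_inv := ?_
        right_inv := fun _ => rfl }
    rintro ⟨⟨X, Y⟩, hX⟩
    simp only at hX
    subst hX
    ext <;> simp [h2]
  · intro X Y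
    rw [h.map_coords, ← i.injective.eq_iff, map_mul, map_ofNat]
    constructor <;> intro h <;> linear_combination h

lemma natCard_shear [Fintype F] (h : IsQuadraticConj i σ A θ) (a k d e f : F) :
    Nat.card {p : F × F //
      (a * (p.1 + k * p.2) ^ 2 + d * p.1 + e * p.2 + f)
        + σ (a * (p.1 + k * p.2) ^ 2 + d * p.1 + e * p.2 + f) = p.1 * σ p.1 + p.2 * σ p.2}
      = ∑ u, Nat.card {y //
        (a * u ^ 2 + d * u + f) + σ (a * u ^ 2 + d * u + f)
          + ((k * σ u + (e - d * k)) * y + σ ((k * σ u + (e - d * k)) * y))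
          = u * σ u + (1 + k * σ k) * (y * σ y)} := by
  rw [← natCard_pairs fun u y => (a * u ^ 2 + d * u + f) + σ (a * u ^ 2 + d * u + f)
          + ((k * σ u + (e - d * k)) * y + σ ((k * σ u + (e - d * k)) * y))
          = u * σ u + (1 + k * σ k) * (y * σ y)]
  refine Nat.card_congr (Equiv.subtypeEquiv
    { toFun := fun p => (p.1 + k * p.2, p.2)
      invFun := fun p => (p.1 - k * p.2, p.2)
      left_inv := fun p => by simp
      right_inv := fun p => by simp } fun p => ?_)
  simp only [Equiv.coe_fn_mk, map_add, map_mul, map_pow, map_sub, h.involutive]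
  constructor <;> intro h <;> linear_combination h

variable [Fintype K]

lemma natCard_norm_fibre (h : IsQuadraticConj i σ A θ) (hK : ringChar K ≠ 2) {c : F}
    (hc : σ c = c) [Decidable (c = 0)] :
    Nat.card {y // y * σ y = c} = if c = 0 then 1 else Fintype.card K + 1 := by
  classical
  obtain ⟨k, rfl⟩ := h.exists_base (Ring.two_ne_zero hK) hc
  rw [h.natCard_coords _ fun p => p.1 ^ 2 - A * p.2 ^ 2 = k, natCard_normForm hK h.not_isSquare,
    if_congr (map_eq_zero i).symm rfl rfl]
  intro X Y
  rw [h.map_coords, ← i.injective.eq_iff, map_sub, map_mul, map_pow, map_pow, ← h.sq_eq]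
  constructor <;> intro h <;> linear_combination h

lemma isConicCount (h : IsQuadraticConj i σ A θ) (hK : ringChar K ≠ 2) (α δ : F) {c : F}
    (hc : σ c = c) : IsConicCount (Fintype.card K) (Nat.card {u //
      α * u ^ 2 + σ (α * u ^ 2) - u * σ u + (δ * u + σ (δ * u)) + c = 0}) := by
  classical
  have h2 : (2 : K) ≠ 0 := Ring.two_ne_zero hK
  obtain ⟨k, rfl⟩ := h.exists_base h2 hc
  obtain ⟨α₁, α₂, rfl⟩ := h.exists_coords α
  obtain ⟨δ₁, δ₂, rfl⟩ := h.exists_coords δ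
  have hA : A ≠ 0 := fun h' => h.not_isSquare (h' ▸ IsSquare.zero)
  rw [h.natCard_coords _ fun p => (2 * α₁ - 1) * p.1 ^ 2 + (4 * α₂ * A) * p.1 * p.2
    + ((2 * α₁ + 1) * A) * p.2 ^ 2 + (2 * δ₁) * p.1 + (2 * δ₂ * A) * p.2 + k = 0]
  · refine isConicCount_natCard hK ?_ _ _ _
    rintro ⟨h₁, -, h₂⟩
    have h₃ := (mul_eq_zero.1 h₂).resolve_right hA
    exact h2 (by linear_combination h₃ - h₁)
  · intro X Y
    rw [← map_eq_zero i]
    simp only [map_add, map_mul, map_pow, map_sub, map_one, map_ofNat, h.map_base, h.map_root,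
      ← h.sq_eq]
    constructor <;> intro h <;> linear_combination h

variable [Fintype F]

lemma natCard_affine_of_ne (h : IsQuadraticConj i σ A θ) (hK : ringChar K ≠ 2)
    {a k d e f : F} (hk : 1 + k * σ k ≠ 0) :
    ∃ Z, IsConicCount (Fintype.card K) Z ∧
      Nat.card {p : F × F //
        (a * (p.1 + k * p.2) ^ 2 + d * p.1 + e * p.2 + f)
          + σ (a * (p.1 + k * p.2) ^ 2 + d * p.1 + e * p.2 + f) = p.1 * σ p.1 + p.2 * σ p.2}
        + Fintype.card K * Z = (Fintype.card K + 1) * Fintype.card F := by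
  classical
  rw [h.natCard_shear]
  set s := 1 + k * σ k with hs
  set e' := e - d * k with he'
  have hσs : σ s = s := by simp [hs, h.involutive, mul_comm]
  set c : F → F := fun u => ((a * u ^ 2 + d * u + f) + σ (a * u ^ 2 + d * u + f) - u * σ u
    + (k * σ u + e') * σ (k * σ u + e') / s) / s with hc
  have hσc : ∀ u, σ (c u) = c u := fun u => by
    simp only [hc, map_add, map_mul, map_pow, map_sub, map_div₀, h.involutive, hσs]
    ring
  have hfib : ∀ u, Nat.card {y //
        (a * u ^ 2 + d * u + f) + σ (a * u ^ 2 + d * u + f)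
          + ((k * σ u + e') * y + σ ((k * σ u + e') * y)) = u * σ u + s * (y * σ y)}
      = if c u = 0 then 1 else Fintype.card K + 1 := fun u => by
    rw [← h.natCard_norm_fibre hK (hσc u)]
    refine Nat.card_congr
      ((Equiv.subRight (σ (k * σ u + e') / s)).subtypeEquiv fun y => ?_)
    simp only [hc, Equiv.subRight_apply, map_sub, map_div₀, hσs, h.involutive, eq_div_iff hk]
    generalize k * σ u + e' = w
    have key : (y - σ w / s) * (σ y - w / s) * s
        = s * (y * σ y) - w * y - σ (w * y) + w * σ w / s := by
      rw [map_mul]; field_simp; ring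
    rw [key]
    constructor <;> intro h <;> linear_combination -h
  refine ⟨Nat.card {u // c u = 0}, ?_, ?_⟩
  · have e₁ : ∀ u, c u = 0 ↔ (s * a) * u ^ 2 + σ ((s * a) * u ^ 2) - u * σ u
        + ((s * d + σ k * e') * u + σ ((s * d + σ k * e') * u))
        + (s * f + σ (s * f) + e' * σ e') = 0 := fun u => by
      simp only [hc, div_eq_zero_iff, hk, or_false]
      rw [← mul_right_inj' hk, mul_zero, mul_add s _ (_ / s), mul_div_cancel₀ _ hk]
      simp only [map_add, map_mul, map_pow, h.involutive, hσs]
      rw [hs]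
      constructor <;> intro h <;> linear_combination h
    rw [Nat.card_congr (Equiv.subtypeEquivRight e₁)]
    refine h.isConicCount hK _ _ ?_
    simp only [map_add, map_mul, h.involutive, hσs]
    ring
  · rw [Finset.sum_congr rfl fun u _ => hfib u, Nat.card_eq_fintype_card, Fintype.card_subtype]
    rw [Finset.card_filter, Finset.mul_sum, ← Finset.sum_add_distrib, ← Finset.card_univ (α := F),
      mul_comm, ← smul_eq_mul, ← Finset.sum_const]
    refine Finset.sum_congr rfl fun u _ => ?_
    split_ifs <;> lia

lemma natCard_affine_of_eq (h : IsQuadraticConj i σ A θ) (hK : ringChar K ≠ 2)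
    {a k d e f : F} (hk : 1 + k * σ k = 0) :
    ∃ m, (m = 0 ∨ m = Fintype.card F) ∧
      Nat.card {p : F × F //
        (a * (p.1 + k * p.2) ^ 2 + d * p.1 + e * p.2 + f)
          + σ (a * (p.1 + k * p.2) ^ 2 + d * p.1 + e * p.2 + f) = p.1 * σ p.1 + p.2 * σ p.2}
        = m + (Fintype.card F - 1) * Fintype.card K := by
  classical
  have hk0 : k ≠ 0 := by rintro rfl; simp at hk
  rw [h.natCard_shear, hk]
  set e' := e - d * k with he'
  set u₀ := σ (-e' / k) with hu₀
  have hw₀ : k * σ u₀ + e' = 0 := by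
    rw [hu₀, h.involutive]; field_simp; ring
  have hw : ∀ u, u ≠ u₀ → k * σ u + e' ≠ 0 := fun u hu hu' => by
    refine hu (σ.injective (mul_left_cancel₀ hk0 ?_))
    linear_combination hu' - hw₀
  rw [← Finset.add_sum_erase _ _ (Finset.mem_univ u₀)]
  refine ⟨_, ?_, congrArg₂ _ rfl ?_⟩
  rotate_left
  · rw [← Finset.card_univ (α := F), ← Finset.card_erase_of_mem (Finset.mem_univ u₀),
      ← smul_eq_mul, ← Finset.sum_const]
    refine Finset.sum_congr rfl fun u hu => ?_
    rw [← Nat.card_eq_fintype_card, ← h.natCard_trace_fibre (Ring.two_ne_zero hK)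
      (hw u (Finset.ne_of_mem_erase hu)) (c := u * σ u
        - ((a * u ^ 2 + d * u + f) + σ (a * u ^ 2 + d * u + f)))]
    · refine Nat.card_congr (Equiv.subtypeEquivRight fun y => ?_)
      constructor <;> intro h <;> linear_combination h
    · simp only [map_add, map_mul, map_pow, map_sub, h.involutive]
      ring
  · simp only [hw₀, zero_mul, map_zero, add_zero]
    by_cases hu : a * u₀ ^ 2 + d * u₀ + f + σ (a * u₀ ^ 2 + d * u₀ + f) = u₀ * σ u₀
    · right
      rw [← Nat.card_eq_fintype_card]
      exact Nat.card_congr (Equiv.subtypeUnivEquiv fun _ => hu)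
    · left
      have : IsEmpty {y : F // a * u₀ ^ 2 + d * u₀ + f + σ (a * u₀ ^ 2 + d * u₀ + f)
        = u₀ * σ u₀} := ⟨fun y => hu y.2⟩
      exact Nat.card_of_isEmpty

end IsQuadraticConj

end QuadraticExtension

section Projective

variable {F : Type} [Field F]

lemma hermPt_smul (q : ℕ) (t : Fˣ) (v : Fin 4 → F) : hermPt q (t • v) ↔ hermPt q v := by
  simp only [hermPt, Pi.smul_apply, Units.smul_def, smul_eq_mul]
  constructor <;> intro h
  · refine mul_left_cancel₀ (pow_ne_zero (q + 1) t.ne_zero) ?_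
    linear_combination h
  · linear_combination (t : F) ^ (q + 1) * h

lemma quadPt_smul (a b c d e f : F) (t : Fˣ) (v : Fin 4 → F) :
    quadPt a b c d e f (t • v) ↔ quadPt a b c d e f v := by
  simp only [quadPt, Pi.smul_apply, Units.smul_def, smul_eq_mul]
  constructor <;> intro h
  · refine mul_left_cancel₀ (pow_ne_zero 2 t.ne_zero) ?_
    linear_combination h
  · linear_combination (t : F) ^ 2 * h

lemma hermPt_quadPt_rep_mk (q : ℕ) (a b c d e f : F) (v : Fin 4 → F) (hv : v ≠ 0) :
    (hermPt q (Projectivization.mk F v hv).rep ∧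
      quadPt a b c d e f (Projectivization.mk F v hv).rep) ↔
      hermPt q v ∧ quadPt a b c d e f v := by
  obtain ⟨t, ht⟩ := Projectivization.exists_smul_eq_mk_rep F v hv
  rw [← ht, hermPt_smul, quadPt_smul]

/-- If the points at infinity of a quadric cone are those of the line spanned by `(m₁, m₂)`,
its common points with the Hermitian surface are the affine ones, the vertex at infinity, and all
remaining points of that line if it lies on the Hermitian surface. -/
lemma natCard_hermPt_quadPt [Fintype F] {q : ℕ} (hq : q ≠ 0) {a b c d e f m₁ m₂ : F}
    (hm : ¬ (m₁ = 0 ∧ m₂ = 0))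
    (hline : ∀ x y, a * x ^ 2 + b * y ^ 2 + c * x * y = 0 ↔ ∃ t, x = t * m₁ ∧ y = t * m₂)
    [Decidable (m₁ ^ (q + 1) + m₂ ^ (q + 1) = 0)] :
    Nat.card {P : Projectivization F (Fin 4 → F) //
        hermPt q P.rep ∧ quadPt a b c d e f P.rep}
      = Nat.card {p : F × F //
          (a * p.1 ^ 2 + b * p.2 ^ 2 + c * p.1 * p.2 + d * p.1 + e * p.2 + f)
            + (a * p.1 ^ 2 + b * p.2 ^ 2 + c * p.1 * p.2 + d * p.1 + e * p.2 + f) ^ q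
            = p.1 ^ (q + 1) + p.2 ^ (q + 1)}
        + ((if m₁ ^ (q + 1) + m₂ ^ (q + 1) = 0 then Fintype.card F else 0) + 1) := by
  classical
  set g : F × F → F := fun p =>
    a * p.1 ^ 2 + b * p.2 ^ 2 + c * p.1 * p.2 + d * p.1 + e * p.2 + f with hg
  have hmq : a * m₁ ^ 2 + b * m₂ ^ 2 + c * m₁ * m₂ = 0 := (hline _ _).2 ⟨1, by simp, by simp⟩
  have hA : ∀ p : F × F, ![1, p.1, p.2, g p] ≠ 0 := fun p h => by
    simpa using congrFun h 0
  have hB : ∀ z : F, ![0, m₁, m₂, z] ≠ 0 := fun z h =>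
    hm ⟨by simpa using congrFun h 1, by simpa using congrFun h 2⟩
  have hC : ![(0 : F), 0, 0, 1] ≠ 0 := fun h => by simpa using congrFun h 3
  let φA : {p : F × F // g p + g p ^ q = p.1 ^ (q + 1) + p.2 ^ (q + 1)} →
      {P : Projectivization F (Fin 4 → F) // hermPt q P.rep ∧ quadPt a b c d e f P.rep} :=
    fun p => ⟨Projectivization.mk F _ (hA p.1), (hermPt_quadPt_rep_mk ..).2
      ⟨by simpa [hermPt] using p.2, by simp [quadPt, hg]⟩⟩
  let φB : {_z : F // m₁ ^ (q + 1) + m₂ ^ (q + 1) = 0} →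
      {P : Projectivization F (Fin 4 → F) // hermPt q P.rep ∧ quadPt a b c d e f P.rep} :=
    fun z => ⟨Projectivization.mk F _ (hB z.1), (hermPt_quadPt_rep_mk ..).2
      ⟨by simpa [hermPt, hq] using z.2.symm, by simpa [quadPt] using hmq.symm⟩⟩
  let φC : Unit →
      {P : Projectivization F (Fin 4 → F) // hermPt q P.rep ∧ quadPt a b c d e f P.rep} :=
    fun _ => ⟨Projectivization.mk F _ hC, (hermPt_quadPt_rep_mk ..).2
      ⟨by simp [hermPt, hq], by simp [quadPt]⟩⟩
  have hbij : Function.Bijective (Sum.elim φA (Sum.elim φB φC)) := by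
    constructor
    · refine Function.Injective.sumElim ?_ (Function.Injective.sumElim ?_ ?_ ?_) ?_
      · rintro ⟨⟨x, y⟩, h⟩ ⟨⟨x', y'⟩, h'⟩ hxy
        obtain ⟨t, ht⟩ := (Projectivization.mk_eq_mk_iff' ..).1 (congrArg Subtype.val hxy)
        have h0 := congrFun ht 0
        have h1 := congrFun ht 1
        have h2 := congrFun ht 2
        simp at h0 h1 h2
        subst h0
        simp at h1 h2
        simp [h1, h2]
      · rintro ⟨z, h⟩ ⟨z', h'⟩ hz
        obtain ⟨t, ht⟩ := (Projectivization.mk_eq_mk_iff' ..).1 (congrArg Subtype.val hz)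
        have h1 := congrFun ht 1
        have h2 := congrFun ht 2
        have h3 := congrFun ht 3
        simp at h1 h2 h3
        have : t = 1 := by
          rcases not_and_or.1 hm with h | h
          · exact (mul_eq_right₀ h).1 h1
          · exact (mul_eq_right₀ h).1 h2
        subst this
        simpa using h3.symm
      · exact fun _ _ _ => rfl
      · rintro ⟨z, h⟩ _ hz
        obtain ⟨t, ht⟩ := (Projectivization.mk_eq_mk_iff' ..).1 (congrArg Subtype.val hz)
        exact hm ⟨by simpa using (congrFun ht 1).symm, by simpa using (congrFun ht 2).symm⟩
      · rintro p (z | u) hz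
        all_goals
          obtain ⟨t, ht⟩ := (Projectivization.mk_eq_mk_iff' ..).1 (congrArg Subtype.val hz)
          simpa using congrFun ht 0
    · rintro ⟨P, hP⟩
      induction P using Projectivization.ind with
      | h v hv =>
      obtain ⟨h₁, h₂⟩ := (hermPt_quadPt_rep_mk ..).1 hP
      by_cases h0 : v 0 = 0
      · simp only [hermPt, quadPt, h0, ne_eq, hq, not_false_eq_true, zero_pow, zero_mul, mul_zero,
          add_zero, OfNat.ofNat_ne_zero] at h₁ h₂
        obtain ⟨t, ht₁, ht₂⟩ := (hline _ _).1 h₂.symm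
        by_cases ht : t = 0
        · subst ht
          simp only [zero_mul] at ht₁ ht₂
          refine ⟨Sum.inr (Sum.inr ()), Subtype.ext ((Projectivization.mk_eq_mk_iff' ..).2 ?_)⟩
          have h3 : v 3 ≠ 0 := fun h3 => hv (by ext j; fin_cases j <;> simp [h0, ht₁, ht₂, h3])
          refine ⟨(v 3)⁻¹, ?_⟩
          ext j; fin_cases j <;> simp [h0, ht₁, ht₂, h3]
        · refine ⟨Sum.inr (Sum.inl ⟨v 3 / t, ?_⟩),
            Subtype.ext ((Projectivization.mk_eq_mk_iff' ..).2 ⟨t⁻¹, ?_⟩)⟩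
          · rw [ht₁, ht₂, mul_pow, mul_pow, ← mul_add] at h₁
            exact (mul_eq_zero.1 h₁.symm).resolve_left (pow_ne_zero _ ht)
          · ext j; fin_cases j <;> simp [h0, ht₁, ht₂, ht, div_eq_inv_mul]
      · have hz : v 3 / v 0 = g (v 1 / v 0, v 2 / v 0) := by
          simp only [quadPt] at h₂
          simp only [hg]
          field_simp
          linear_combination h₂
        refine ⟨Sum.inl ⟨(v 1 / v 0, v 2 / v 0), ?_⟩,
          Subtype.ext ((Projectivization.mk_eq_mk_iff' ..).2 ⟨(v 0)⁻¹, ?_⟩)⟩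
        · rw [← hz]
          simp only [hermPt] at h₁
          simp only [div_pow]
          rw [← add_div, ← h₁]
          field_simp
          ring
        · ext j; fin_cases j <;> simp [h0, ← hz] <;> field_simp
  rw [← Nat.card_eq_of_bijective _ hbij, Nat.card_sum, Nat.card_sum, Nat.card_unique (α := Unit)]
  congr 2
  split_ifs with h
  · rw [← Nat.card_eq_fintype_card]
    exact Nat.card_congr (Equiv.subtypeUnivEquiv fun _ => h)
  · have : IsEmpty {_z : F // m₁ ^ (q + 1) + m₂ ^ (q + 1) = 0} := ⟨fun z => h z.2⟩
    exact Nat.card_of_isEmpty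

end Projective

lemma mem_sizes_of_isConicCount {q Z N : ℕ} (hq : 3 < q) (hZ : IsConicCount q Z)
    (hN : N + q * Z = (q + 1) * q ^ 2) :
    N + (0 + 1) ∈
      ({q ^ 3 - q ^ 2 + 1, q ^ 3 - q ^ 2 + q + 1, q ^ 3 - q + 1, q ^ 3 + 1,
        q ^ 3 + q + 1, q ^ 3 + q ^ 2 - q + 1, q ^ 3 + q ^ 2 + 1,
        q ^ 3 + 2 * q ^ 2 - q + 1} : Set ℕ) := by
  have h₁ : q ≤ q ^ 2 := Nat.le_self_pow (by norm_num) q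
  have h₂ : q ^ 2 ≤ q ^ 3 := Nat.pow_le_pow_right (by omega) (by norm_num)
  have h₃ : (q + 1) * q ^ 2 = q ^ 3 + q ^ 2 := by ring
  have h₄ : q * q = q ^ 2 := (sq q).symm
  simp only [Set.mem_insert_iff, Set.mem_singleton_iff]
  rw [h₃] at hN
  rcases hZ with rfl | rfl | hZ | rfl | rfl | hZ | rfl
  · omega
  · omega
  · have : q * Z + q = q ^ 2 := by rw [← h₄, ← hZ]; ring
    omega
  · omega
  · rw [mul_add] at hN; omega
  · have : q * Z + q = 2 * q ^ 2 := by rw [← h₄]; linear_combination q * hZ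
    omega
  · have : q * (2 * q) = 2 * q ^ 2 := by ring
    omega

/-- A field of order `q ^ 2`, `q` an odd prime power, is a quadratic extension of one of order `q`
with conjugation `x ↦ x ^ q`. -/
lemma exists_isQuadraticConj {F : Type} [Field F] [Fintype F] {p n q : ℕ} (hp : p.Prime)
    (hodd : Odd p) (hn : 0 < n) (hq : q = p ^ n) (hF : Fintype.card F = q ^ 2) :
    ∃ (K : Type) (_ : Field K) (_ : Fintype K) (i : K →+* F) (σ : F →+* F) (A : K) (θ : F),
      Fintype.card K = q ∧ ringChar K ≠ 2 ∧ (∀ x, σ x = x ^ q) ∧ IsQuadraticConj i σ A θ := by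
  classical
  have : Fact p.Prime := ⟨hp⟩
  have hF' : Fintype.card F = p ^ (n * 2) := by rw [hF, hq, pow_mul]
  have : CharP F p := charP_of_card_eq_prime_pow hF'
  let _ := ZMod.algebra F p
  let _ : Fintype (GaloisField p n) := Fintype.ofFinite _
  have hKq : Fintype.card (GaloisField p n) = q := by
    rw [← Nat.card_eq_fintype_card, GaloisField.card p n hn.ne', hq]
  have hrank : Module.finrank (ZMod p) F = n * 2 :=
    Nat.pow_right_injective hp.two_le (by
      simpa [hF'] using FiniteField.pow_finrank_eq_card p (k := F))
  obtain ⟨j⟩ : Nonempty (GaloisField p n →ₐ[ZMod p] F) :=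
    FiniteField.nonempty_algHom_of_finrank_dvd (by
      rw [hrank, GaloisField.finrank p hn.ne']; exact dvd_mul_right _ _)
  set i : GaloisField p n →+* F := j.toRingHom with hi
  have hp2 : p ≠ 2 := by rintro rfl; exact absurd hodd (by decide)
  have hK2 : ringChar (GaloisField p n) ≠ 2 := by
    rwa [ringChar.eq (GaloisField p n) p]
  have hF2 : ringChar F ≠ 2 := by rwa [ringChar.eq F p]
  have hqo : Odd q := hq ▸ hodd.pow
  obtain ⟨A, hA⟩ := FiniteField.exists_nonsquare hK2
  have hA0 : A ≠ 0 := fun h => hA (h ▸ IsSquare.zero)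
  have hAq : A ^ (q - 1) = 1 := by rw [← hKq]; exact FiniteField.pow_card_sub_one_eq_one A hA0
  obtain ⟨r, hr⟩ := hqo
  have hsq : IsSquare (i A) := by
    rw [FiniteField.isSquare_iff hF2 ((map_ne_zero i).2 hA0), hF]
    have : q ^ 2 / 2 = (q - 1) * (r + 1) := by
      have : q ^ 2 = 2 * ((q - 1) * (r + 1)) + 1 := by
        subst hr
        simp only [Nat.add_sub_cancel]
        ring
      omega
    rw [this, ← map_pow, pow_mul, hAq, one_pow, map_one]
  obtain ⟨θ, hθ⟩ := hsq
  have hθ2 : θ ^ 2 = i A := by rw [hθ, sq]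
  have hAr : A ^ r = -1 := by
    have h1 := FiniteField.pow_dichotomy hK2 hA0
    have h2 := (FiniteField.isSquare_iff hK2 hA0).not.1 hA
    rw [hKq, show q / 2 = r by omega] at h1 h2
    exact h1.resolve_left h2
  have hθq : θ ^ q = -θ := by
    rw [hr, pow_succ, pow_mul, hθ2, ← map_pow, hAr]
    simp
  refine ⟨GaloisField p n, inferInstance, inferInstance, i, iterateFrobenius F p n, A, θ, hKq, hK2,
    fun x => by rw [iterateFrobenius_def, hq], ?_⟩
  refine ⟨hA, hθ2, fun k => ?_, ?_, ?_⟩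
  · rw [iterateFrobenius_def, ← hq, ← map_pow, ← hKq, FiniteField.pow_card]
  · rw [iterateFrobenius_def, ← hq, hθq]
  · rw [Fintype.bijective_iff_injective_and_card]
    refine ⟨?_, by rw [Fintype.card_prod, hKq, hF, sq]⟩
    rintro ⟨X, Y⟩ ⟨X', Y'⟩ h
    simp only at h
    by_cases hY : Y = Y'
    · subst hY
      rw [i.injective (add_right_cancel h)]
    · refine absurd ⟨(X - X') / (Y' - Y), i.injective ?_⟩ hA
      have hY' : i Y' - i Y ≠ 0 := by
        rw [← map_sub]; exact (map_ne_zero i).2 (sub_ne_zero.2 (Ne.symm hY))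
      have : θ = (i X - i X') / (i Y' - i Y) := by
        rw [eq_div_iff hY']; linear_combination -h
      rw [map_mul, map_div₀, map_sub, map_sub, ← this, hθ]

theorem cone_intersection_sizes
    (q : ℕ) (hq : ∃ p n : ℕ, p.Prime ∧ Odd p ∧ 0 < n ∧ q = p ^ n) (hq3 : 3 < q)
    (F : Type) [Field F] [Fintype F] (hF : Fintype.card F = q ^ 2)
    (a b c d e f : F)
    (hΔ : 4 * a * b - c ^ 2 = 0) (habc : ¬ (a = 0 ∧ b = 0 ∧ c = 0)) :
    Nat.card {P : Projectivization F (Fin 4 → F) //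
        hermPt q P.rep ∧ quadPt a b c d e f P.rep} ∈
      ({q ^ 3 - q ^ 2 + 1, q ^ 3 - q ^ 2 + q + 1, q ^ 3 - q + 1, q ^ 3 + 1,
        q ^ 3 + q + 1, q ^ 3 + q ^ 2 - q + 1, q ^ 3 + q ^ 2 + 1,
        q ^ 3 + 2 * q ^ 2 - q + 1} : Set ℕ) := by
  obtain ⟨p, n, hp, hodd, hn, hqp⟩ := hq
  obtain ⟨K, _, _, i, σ, A, θ, hKq, hK2, hσ, h⟩ := exists_isQuadraticConj hp hodd hn hqp hF
  classical
  have hq0 : q ≠ 0 := by omega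
  by_cases ha : a = 0
  · subst ha
    have hc : c = 0 := by simpa using hΔ
    subst hc
    have hb : b ≠ 0 := fun hb => habc ⟨rfl, hb, rfl⟩
    obtain ⟨Z, hZ, hN⟩ := h.natCard_affine_of_ne hK2 (a := b) (k := 0) (d := e) (e := d) (f := f)
      (by simp)
    rw [natCard_hermPt_quadPt hq0 (m₁ := 1) (m₂ := 0) (by simp)
      (fun x y => by simp [hb]), if_neg (by simp)]
    rw [← Nat.card_congr (Equiv.subtypeEquiv (Equiv.prodComm F F)
      (p := fun p : F × F =>
        (0 * p.1 ^ 2 + b * p.2 ^ 2 + 0 * p.1 * p.2 + d * p.1 + e * p.2 + f)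
          + (0 * p.1 ^ 2 + b * p.2 ^ 2 + 0 * p.1 * p.2 + d * p.1 + e * p.2 + f) ^ q
          = p.1 ^ (q + 1) + p.2 ^ (q + 1)) fun p => by
        simp only [← hσ, pow_succ, pow_zero, one_mul, map_add, map_mul, map_zero, Equiv.prodComm_apply, Prod.fst_swap,
          Prod.snd_swap]
        constructor <;> intro h <;> linear_combination h)] at hN
    rw [hKq, hF] at hN
    rw [hKq] at hZ
    exact mem_sizes_of_isConicCount hq3 hZ hN
  · have h2 : (2 : F) ≠ 0 := by
      rw [← map_ofNat i 2]; exact (map_ne_zero i).2 (Ring.two_ne_zero hK2)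
    have h4 : (4 : F) ≠ 0 := by
      rw [show (4 : F) = 2 * 2 by norm_num]; exact mul_ne_zero h2 h2
    set k := c / (2 * a) with hk
    have hform : ∀ x y, a * x ^ 2 + b * y ^ 2 + c * x * y = a * (x + k * y) ^ 2 := fun x y => by
      rw [hk]
      apply mul_left_cancel₀ (mul_ne_zero h4 ha)
      field_simp
      linear_combination y ^ 2 * hΔ
    have hline : ∀ x y, a * x ^ 2 + b * y ^ 2 + c * x * y = 0 ↔ ∃ t, x = t * (-k) ∧ y = t * 1 :=
      fun x y => by
        rw [hform]
        simp only [mul_eq_zero, ha, false_or, ne_eq, OfNat.ofNat_ne_zero, not_false_eq_true,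
          pow_eq_zero_iff]
        constructor
        · exact fun h => ⟨y, by linear_combination h, by ring⟩
        · rintro ⟨t, rfl, rfl⟩; ring
    have hiso : (-k) ^ (q + 1) + 1 ^ (q + 1) = 1 + k * σ k := by
      rw [pow_succ, ← hσ, map_neg]; ring
    rw [natCard_hermPt_quadPt hq0 (by simp) hline, hiso]
    have e₁ : ∀ p : F × F,
        ((a * p.1 ^ 2 + b * p.2 ^ 2 + c * p.1 * p.2 + d * p.1 + e * p.2 + f)
          + (a * p.1 ^ 2 + b * p.2 ^ 2 + c * p.1 * p.2 + d * p.1 + e * p.2 + f) ^ q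
          = p.1 ^ (q + 1) + p.2 ^ (q + 1)) ↔
        ((a * (p.1 + k * p.2) ^ 2 + d * p.1 + e * p.2 + f)
          + σ (a * (p.1 + k * p.2) ^ 2 + d * p.1 + e * p.2 + f)
          = p.1 * σ p.1 + p.2 * σ p.2) := fun p => by
      rw [hform, pow_succ p.1, pow_succ p.2, ← hσ, ← hσ, ← hσ, mul_comm (σ p.1), mul_comm (σ p.2)]
    rw [Nat.card_congr (Equiv.subtypeEquivRight e₁)]
    by_cases hk0 : 1 + k * σ k = 0
    · rw [if_pos hk0]
      obtain ⟨m, hm, hN⟩ := h.natCard_affine_of_eq hK2 (a := a) (d := d) (e := e) (f := f) hk0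
      rw [hN]
      rw [hF] at hm ⊢
      rw [hKq, tsub_mul, one_mul, show q ^ 2 * q = q ^ 3 from (pow_succ q 2).symm]
      have : q ≤ q ^ 3 := Nat.le_self_pow (by norm_num) q
      simp only [Set.mem_insert_iff, Set.mem_singleton_iff]
      omega
    · rw [if_neg hk0]
      obtain ⟨Z, hZ, hN⟩ := h.natCard_affine_of_ne hK2 (a := a) (d := d) (e := e) (f := f) hk0
      rw [hKq, hF] at hN
      rw [hKq] at hZ
      exact mem_sizes_of_isConicCount hq3 hZ hN
end

section
/- Suppose either Δ = 4ab − c² is a nonsquare in F, or Δ = 0 with (a,b,c) ≠ (0,0,0) (i.e. Q is elliptic or a cone). Then the number of triples (x,y,z) ∈ F³ satisfying both z^q + z = x^(q+1) + y^(q+1) and z = a·x² + b·y² + c·x·y + d·x + e·y + f is one of the seven values q³−q², q³−q²+q, q³−q, q³, q³+q, q³+q²−q, q³+q². -/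
/-- The number of solutions of `f x = k`, as an integer. -/
noncomputable def fiberCard {α M : Type*} (f : α → M) (k : M) : ℤ :=
  (Nat.card {x // f x = k} : ℤ)

section FiberCard

variable {α β M : Type*}

theorem fiberCard_comp_equiv (f : β → M) (e : α ≃ β) (k : M) :
    fiberCard (fun x => f (e x)) k = fiberCard f k := by
  unfold fiberCard
  exact congrArg _ (Nat.card_congr (e.subtypeEquiv fun _ => Iff.rfl))

theorem fiberCard_eq_sum [Fintype α] [DecidableEq M] (f : α → M) (k : M) :
    fiberCard f k = ∑ x, if f x = k then (1 : ℤ) else 0 := by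
  unfold fiberCard
  rw [Nat.card_eq_fintype_card, Fintype.card_subtype]
  simp

theorem fiberCard_add [Finite α] [Finite β] [AddCommGroup M] [Fintype M] (f : α → M) (g : β → M) (k : M) :
    fiberCard (fun x : α × β => f x.1 + g x.2) k = ∑ s, fiberCard f s * fiberCard g (k - s) := by
  classical
  have := Fintype.ofFinite α
  have := Fintype.ofFinite β
  simp only [fiberCard_eq_sum, Finset.sum_mul_sum, Fintype.sum_prod_type]
  rw [Finset.sum_comm]
  simp_rw [Finset.sum_comm (s := (Finset.univ : Finset M))]
  rw [Finset.sum_comm]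
  refine Finset.sum_congr rfl fun x _ => Finset.sum_congr rfl fun y _ => ?_
  rw [Finset.sum_eq_single (f x) (by simp +contextual [eq_comm]) (by simp)]
  simp [eq_sub_iff_add_eq, add_comm]

end FiberCard

section Counting

variable {K : Type*} [Field K] [Fintype K]

theorem sum_quadraticChar_mul_sub [DecidableEq K] (h2 : ringChar K ≠ 2) (k : K) :
    ∑ s, quadraticChar K s * quadraticChar K (k - s) =
      quadraticChar K (-1) * (Fintype.card K * (if k = 0 then 1 else 0) - 1) := by
  split_ifs with hk
  · subst hk
    have h : ∀ s : K, quadraticChar K s * quadraticChar K (0 - s) =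
        quadraticChar K (-1) * (1 - if s = 0 then 1 else 0) := by
      intro s
      rw [zero_sub, ← neg_one_mul, map_mul]
      split_ifs with hs
      · simp [hs]
      · linear_combination quadraticChar K (-1) * quadraticChar_sq_one hs
    simp_rw [h, ← Finset.mul_sum, Finset.sum_sub_distrib]
    simp
  · have h := jacobiSum_nontrivial_inv (quadraticChar_ne_one h2)
    rw [(quadraticChar_isQuadratic K).inv, jacobiSum] at h
    rw [← Equiv.sum_comp (Equiv.mulLeft₀ k hk)]
    have h' : ∀ t : K, quadraticChar K (Equiv.mulLeft₀ k hk t) *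
        quadraticChar K (k - Equiv.mulLeft₀ k hk t) =
        quadraticChar K t * quadraticChar K (1 - t) := by
      intro t
      simp only [Equiv.mulLeft₀_apply]
      rw [show k - k * t = k * (1 - t) by ring, map_mul, map_mul]
      linear_combination quadraticChar K t * quadraticChar K (1 - t) * quadraticChar_sq_one hk
    simp_rw [h', h]
    ring

theorem fiberCard_quadratic [DecidableEq K] (h2 : ringChar K ≠ 2) {w : K} (hw : w ≠ 0) (l k : K) :
    fiberCard (fun x => w * x ^ 2 + l * x) k = quadraticChar K (w * (k + l ^ 2 / (4 * w))) + 1 := by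
  have h20 : (2 : K) ≠ 0 := Ring.two_ne_zero h2
  have h40 : (4 : K) ≠ 0 := by
    rw [show (4 : K) = 2 * 2 by norm_num]
    exact mul_ne_zero h20 h20
  rw [← quadraticChar_card_sqrts h2, fiberCard, Set.toFinset_card, ← Nat.card_eq_fintype_card]
  refine congrArg _ (Nat.card_congr
    (((Equiv.mulLeft₀ w hw).trans (Equiv.addRight (l / 2))).subtypeEquiv fun x => ?_))
  simp only [Equiv.trans_apply, Equiv.mulLeft₀_apply, Equiv.coe_addRight, Set.mem_ofPred_eq]
  rw [← mul_right_inj' hw, ← sub_eq_zero, ← sub_eq_zero (a := (_ : K) ^ 2)]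
  refine Eq.congr ?_ rfl
  field_simp
  ring

theorem fiberCard_linear {l : K} (hl : l ≠ 0) (k : K) : fiberCard (fun x => l * x) k = 1 := by
  classical
  simp [fiberCard_eq_sum, ← eq_div_iff_mul_eq hl, mul_comm l]

theorem fiberCard_quadratic_mem (h2 : ringChar K ≠ 2) {w : K} (hw : w ≠ 0) (l k : K) :
    fiberCard (fun x => w * x ^ 2 + l * x) k ∈ ({0, 1, 2} : Set ℤ) := by
  classical
  rw [fiberCard_quadratic h2 hw]
  rcases quadraticChar_isQuadratic K (w * (k + l ^ 2 / (4 * w))) with h | h | h <;> simp [h]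

theorem sum_fiberCard_quadratic_sub (h2 : ringChar K ≠ 2) {w : K} (hw : w ≠ 0) (l k : K) :
    ∑ s, fiberCard (fun x => w * x ^ 2 + l * x) (k - s) = Fintype.card K := by
  classical
  refine (Equiv.sum_comp (Equiv.subLeft k) (fiberCard fun x => w * x ^ 2 + l * x)).trans ?_
  simp_rw [fiberCard_quadratic h2 hw, Finset.sum_add_distrib, map_mul, ← Finset.mul_sum]
  have h := Equiv.sum_comp (Equiv.addRight (l ^ 2 / (4 * w))) (quadraticChar K)
  simp only [Equiv.coe_addRight, quadraticChar_sum_zero h2] at h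
  rw [h]
  simp

theorem fiberCard_quadratic_add_quadratic [DecidableEq K] (h2 : ringChar K ≠ 2) {w₁ w₂ : K}
    (hw₁ : w₁ ≠ 0) (hw₂ : w₂ ≠ 0) (l₁ l₂ : K) :
    ∃ (η : ℤ) (κ : K), (η = 1 ∨ η = -1) ∧ ∀ k,
      fiberCard (fun v : K × K => (w₁ * v.1 ^ 2 + l₁ * v.1) + (w₂ * v.2 ^ 2 + l₂ * v.2)) k =
        Fintype.card K - η + η * Fintype.card K * (if k = κ then 1 else 0) := by
  refine ⟨quadraticChar K (-(w₁ * w₂)), -(l₁ ^ 2 / (4 * w₁) + l₂ ^ 2 / (4 * w₂)),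
    quadraticChar_dichotomy (neg_ne_zero.mpr (mul_ne_zero hw₁ hw₂)), fun k => ?_⟩
  have key := sum_fiberCard_quadratic_sub h2 hw₂ l₂ k
  rw [fiberCard_add (fun x => w₁ * x ^ 2 + l₁ * x) (fun x => w₂ * x ^ 2 + l₂ * x)]
  simp_rw [fiberCard_quadratic h2 hw₁, add_mul, Finset.sum_add_distrib, one_mul, key,
    fiberCard_quadratic h2 hw₂, mul_add, Finset.sum_add_distrib, mul_one, ← mul_add, map_mul,
    ← Finset.mul_sum]
  have h₁ := Equiv.sum_comp (Equiv.addRight (l₁ ^ 2 / (4 * w₁))) (quadraticChar K)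
  simp only [Equiv.coe_addRight, quadraticChar_sum_zero h2] at h₁
  have h₃ := sum_quadraticChar_mul_sub h2 (k + (l₁ ^ 2 / (4 * w₁) + l₂ ^ 2 / (4 * w₂)))
  rw [← Equiv.sum_comp (Equiv.addRight (l₁ ^ 2 / (4 * w₁)))] at h₃
  simp only [Equiv.coe_addRight] at h₃
  have h₄ : ∀ s, quadraticChar K w₁ * quadraticChar K (s + l₁ ^ 2 / (4 * w₁)) *
      (quadraticChar K w₂ * quadraticChar K (k - s + l₂ ^ 2 / (4 * w₂))) =
      quadraticChar K w₁ * quadraticChar K w₂ * (quadraticChar K (s + l₁ ^ 2 / (4 * w₁)) *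
      quadraticChar K (k + (l₁ ^ 2 / (4 * w₁) + l₂ ^ 2 / (4 * w₂)) -
        (s + l₁ ^ 2 / (4 * w₁)))) := by
    intro s
    rw [show k - s + l₂ ^ 2 / (4 * w₂) = k + (l₁ ^ 2 / (4 * w₁) + l₂ ^ 2 / (4 * w₂)) -
      (s + l₁ ^ 2 / (4 * w₁)) by ring]
    ring
  simp_rw [h₄, ← Finset.mul_sum, h₃, h₁, ← add_eq_zero_iff_eq_neg]
  rw [← neg_one_mul (w₁ * w₂), map_mul, map_mul]
  ring

/-- Affine quadrics in dimension four whose quadratic part is diagonal of rank at least three. -/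
theorem fiberCard_diagonal_mem (h2 : ringChar K ≠ 2) {w₀ w₁ w₂ : K} (hw₀ : w₀ ≠ 0) (hw₁ : w₁ ≠ 0)
    (hw₂ : w₂ ≠ 0) (w₃ l₀ l₁ l₂ l₃ k : K) {q : ℤ} (hq : q = Fintype.card K) :
    fiberCard (fun v : (K × K) × K × K =>
        ((w₀ * v.1.1 ^ 2 + l₀ * v.1.1) + (w₁ * v.1.2 ^ 2 + l₁ * v.1.2)) +
        ((w₂ * v.2.1 ^ 2 + l₂ * v.2.1) + (w₃ * v.2.2 ^ 2 + l₃ * v.2.2))) k ∈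
      ({q ^ 3 - q ^ 2, q ^ 3 - q ^ 2 + q, q ^ 3 - q, q ^ 3, q ^ 3 + q,
        q ^ 3 + q ^ 2 - q, q ^ 3 + q ^ 2} : Set ℤ) := by
  classical
  obtain ⟨η, κ, hη, h⟩ := fiberCard_quadratic_add_quadratic h2 hw₀ hw₁ l₀ l₁
  have hpair := fiberCard_add (fun v : K × K => (w₀ * v.1 ^ 2 + l₀ * v.1) +
    (w₁ * v.2 ^ 2 + l₁ * v.2)) (fun v : K × K => (w₂ * v.1 ^ 2 + l₂ * v.1) +
    (w₃ * v.2 ^ 2 + l₃ * v.2)) k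
  rw [hpair]
  simp_rw [h, ← hq, add_mul, Finset.sum_add_distrib, mul_assoc, ← Finset.mul_sum, ite_mul,
    one_mul, zero_mul, Finset.sum_ite_eq', Finset.mem_univ, if_true]
  simp only [Set.mem_insert_iff, Set.mem_singleton_iff]
  by_cases hw₃ : w₃ = 0
  · subst hw₃
    simp_rw [zero_mul, zero_add]
    have hrow := fiberCard_add (fun x => w₂ * x ^ 2 + l₂ * x) (fun x => l₃ * x)
    have hsum := sum_fiberCard_quadratic_sub h2 hw₂ l₂
    rw [← hq] at hsum
    by_cases hl₃ : l₃ = 0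
    · subst hl₃
      have hz : ∀ s, fiberCard (fun x : K => (0 : K) * x) s = if s = 0 then q else 0 := by
        intro s
        rw [fiberCard_eq_sum]
        split_ifs with hs
        · simp [hs, hq]
        · simp [Ne.symm hs]
      have hrow' : ∀ s, fiberCard (fun v : K × K => w₂ * v.1 ^ 2 + l₂ * v.1 + 0 * v.2) s =
          fiberCard (fun x => w₂ * x ^ 2 + l₂ * x) s * q := by
        intro s
        rw [hrow]
        simp_rw [hz, mul_ite, mul_zero, sub_eq_zero, Finset.sum_ite_eq]
        simp
      simp_rw [hrow', ← Finset.sum_mul, hsum]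
      rcases fiberCard_quadratic_mem h2 hw₂ l₂ (k - κ) with h' | h' | h' <;>
      rcases hη with rfl | rfl <;> rw [h'] <;> grind
    · have hrow' : ∀ s, fiberCard (fun v : K × K => w₂ * v.1 ^ 2 + l₂ * v.1 + l₃ * v.2) s = q := by
        intro s
        rw [hrow]
        simp_rw [fiberCard_linear hl₃, mul_one]
        refine Eq.trans ?_ (hsum 0)
        exact (Equiv.sum_comp (Equiv.subLeft 0) (fiberCard fun x => w₂ * x ^ 2 + l₂ * x)).symm
      simp_rw [hrow', Finset.sum_const, Finset.card_univ, nsmul_eq_mul, ← hq]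
      grind
  · obtain ⟨η', κ', hη', h'⟩ := fiberCard_quadratic_add_quadratic h2 hw₂ hw₃ l₂ l₃
    rw [← hq] at h'
    have hδ : ∑ s, (if k - s = κ' then (1 : ℤ) else 0) = 1 := by
      simp_rw [sub_eq_iff_eq_add, ← sub_eq_iff_eq_add' (a := k)]
      simp
    simp_rw [h', Finset.sum_add_distrib, ← Finset.mul_sum, hδ, Finset.sum_const, Finset.card_univ,
      nsmul_eq_mul, ← hq]
    split_ifs <;> rcases hη with rfl | rfl <;> rcases hη' with rfl | rfl <;> grind

/-- Affine quadrics in dimension four whose quadratic part has rank at least three. -/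
theorem fiberCard_quadraticForm_mem (h2 : ringChar K ≠ 2) {V : Type*} [AddCommGroup V] [Module K V]
    (hV : Module.finrank K V = 4) (Q : QuadraticForm K V) (L : V →ₗ[K] K)
    (hQ : ∀ u v, (∀ x, QuadraticMap.polar Q u x = 0) → (∀ x, QuadraticMap.polar Q v x = 0) →
      ¬ LinearIndependent K ![u, v]) (k : K) {q : ℤ} (hq : q = Fintype.card K) :
    fiberCard (fun v => Q v + L v) k ∈
      ({q ^ 3 - q ^ 2, q ^ 3 - q ^ 2 + q, q ^ 3 - q, q ^ 3, q ^ 3 + q,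
        q ^ 3 + q ^ 2 - q, q ^ 3 + q ^ 2} : Set ℤ) := by
  have : FiniteDimensional K V := Module.finite_of_finrank_pos (by omega)
  have : Invertible (2 : K) := invertibleOfNonzero (Ring.two_ne_zero h2)
  obtain ⟨w, ⟨e⟩⟩ : ∃ w : Fin 4 → K, Q.Equivalent (QuadraticMap.weightedSumSquares K w) :=
    hV ▸ Q.equivalent_weightedSumSquares
  have hQe : ∀ v, Q (e.toLinearEquiv.symm v) = ∑ i, w i * v i ^ 2 := by
    intro v
    rw [← e.map_app]
    have : e (e.toLinearEquiv.symm v) = v := e.toLinearEquiv.apply_symm_apply v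
    rw [this, QuadraticMap.weightedSumSquares_apply]
    simp [sq]
  have hrad : ∀ i, w i = 0 → ∀ x,
      QuadraticMap.polar Q (e.toLinearEquiv.symm (Pi.single i 1)) x = 0 := by
    intro i hi x
    obtain ⟨y, rfl⟩ := e.toLinearEquiv.symm.surjective x
    rw [QuadraticMap.polar, ← map_add, hQe, hQe, hQe, ← Finset.sum_sub_distrib,
      ← Finset.sum_sub_distrib]
    refine Finset.sum_eq_zero fun j _ => ?_
    by_cases hj : j = i
    · simp [hj, hi]
    · simp [hj]
  obtain ⟨i₀, hi₀⟩ : ∃ i₀, ∀ i, i ≠ i₀ → w i ≠ 0 := by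
    by_cases h : ∃ i₀, w i₀ = 0
    · obtain ⟨i₀, h₀⟩ := h
      refine ⟨i₀, fun i hi h₁ => hQ _ _ (hrad i h₁) (hrad i₀ h₀) ?_⟩
      rw [LinearIndependent.pair_iff]
      intro s t hst
      rw [← map_smul, ← map_smul, ← map_add, LinearEquiv.map_eq_zero_iff] at hst
      have h₁ := congrFun hst i
      have h₂ := congrFun hst i₀
      simp [hi] at h₁
      simp [hi.symm] at h₂
      exact ⟨h₁, h₂⟩
    · push Not at h
      exact ⟨0, fun i _ => h i⟩
  let σ : Equiv.Perm (Fin 4) := Equiv.swap i₀ 3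
  have hσ : ∀ i, i ≠ 3 → w (σ i) ≠ 0 := by
    intro i hi
    exact hi₀ _ fun h => hi (σ.injective (h.trans (Equiv.swap_apply_right i₀ 3).symm))
  let φ : (K × K) × K × K ≃ V :=
    { toFun := fun v => e.toLinearEquiv.symm fun i => ![v.1.1, v.1.2, v.2.1, v.2.2] (σ.symm i)
      invFun := fun x =>
        let y := e.toLinearEquiv x
        ((y (σ 0), y (σ 1)), y (σ 2), y (σ 3))
      left_inv := fun v => by simp
      right_inv := fun x => by
        rw [LinearEquiv.symm_apply_eq]
        funext i
        obtain ⟨j, rfl⟩ := σ.surjective i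
        rw [Equiv.symm_apply_apply]
        fin_cases j <;> rfl }
  let l : Fin 4 → K := fun i => L (e.toLinearEquiv.symm (Pi.single i 1))
  have hL : ∀ v, L (e.toLinearEquiv.symm v) = ∑ i, l i * v i := by
    intro v
    conv_lhs => rw [← Finset.univ_sum_single v]
    simp_rw [map_sum]
    refine Finset.sum_congr rfl fun i _ => ?_
    rw [show Pi.single i (v i) = v i • (Pi.single i 1 : Fin 4 → K) by
      rw [← Pi.single_smul, smul_eq_mul, mul_one], map_smul, map_smul, smul_eq_mul, mul_comm]
  have hφ : (fun v => Q (φ v) + L (φ v)) = fun v : (K × K) × K × K =>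
      ((w (σ 0) * v.1.1 ^ 2 + l (σ 0) * v.1.1) + (w (σ 1) * v.1.2 ^ 2 + l (σ 1) * v.1.2)) +
      ((w (σ 2) * v.2.1 ^ 2 + l (σ 2) * v.2.1) + (w (σ 3) * v.2.2 ^ 2 + l (σ 3) * v.2.2)) := by
    funext v
    simp only [φ, Equiv.coe_fn_mk]
    rw [hQe, hL, ← Equiv.sum_comp σ, ← Equiv.sum_comp σ fun i => l i * _]
    simp only [Equiv.symm_apply_apply, Fin.sum_univ_four, Matrix.cons_val]
    ring
  rw [← fiberCard_comp_equiv _ φ, hφ]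
  exact fiberCard_diagonal_mem h2 (hσ 0 (by decide)) (hσ 1 (by decide)) (hσ 2 (by decide))
    _ _ _ _ _ _ hq

end Counting

section Conjugation

variable {F : Type*} [Field F] {q : ℕ}

/-- The fixed field of an odd power map which is additive. -/
def fixedSubfield (hodd : Odd q) (hadd : ∀ x y : F, (x + y) ^ q = x ^ q + y ^ q) : Subfield F where
  carrier := {x | x ^ q = x}
  mul_mem' {x y} hx hy := by
    simp only [Set.mem_ofPred_eq] at *
    rw [mul_pow, hx, hy]
  one_mem' := one_pow q
  add_mem' {x y} hx hy := by
    simp only [Set.mem_ofPred_eq] at *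
    rw [hadd, hx, hy]
  zero_mem' := zero_pow hodd.pos.ne'
  neg_mem' {x} hx := by
    simp only [Set.mem_ofPred_eq] at *
    rw [hodd.neg_pow, hx]
  inv_mem' x hx := by
    simp only [Set.mem_ofPred_eq] at *
    rw [inv_pow, hx]

variable (hodd : Odd q) (hadd : ∀ x y : F, (x + y) ^ q = x ^ q + y ^ q)

theorem mem_fixedSubfield {x : F} : x ∈ fixedSubfield hodd hadd ↔ x ^ q = x := Iff.rfl

/-- The map `x ↦ x ^ q + x` onto the fixed field. -/
def fixedTrace (hinv : ∀ x : F, (x ^ q) ^ q = x) : F →ₗ[fixedSubfield hodd hadd]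
    fixedSubfield hodd hadd where
  toFun x := ⟨x ^ q + x, by rw [mem_fixedSubfield, hadd, hinv, add_comm]⟩
  map_add' x y := by
    ext
    simp only [hadd, Subfield.coe_add]
    ring
  map_smul' k x := by
    have hk : (k : F) ^ q = k := k.2
    ext
    simp only [Subfield.smul_def, smul_eq_mul, mul_pow, hk, RingHom.id_apply, Subfield.coe_mul]
    ring

theorem coe_fixedTrace (hinv : ∀ x : F, (x ^ q) ^ q = x) (x : F) :
    (fixedTrace hodd hadd hinv x : F) = x ^ q + x := rfl

theorem card_fixedSubfield [Fintype F] (h2 : (2 : F) ≠ 0) (h1 : 1 < q)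
    (hF : Fintype.card F = q ^ 2) : Nat.card (fixedSubfield hodd hadd) = q := by
  have hinv : ∀ x : F, (x ^ q) ^ q = x := fun x => by
    rw [← pow_mul, ← sq, ← hF, FiniteField.pow_card]
  have hsub : ∀ x y : F, (x - y) ^ q = x ^ q - y ^ q := fun x y => by
    rw [sub_eq_add_neg, hadd, hodd.neg_pow, sub_eq_add_neg]
  have h2q : (2 : F) ^ q = 2 := by
    rw [← one_add_one_eq_two, hadd, one_pow]
  obtain ⟨g, hg⟩ : ∃ g : F, g ^ q ≠ g := by
    by_contra! h
    have := (FiniteField.forall_pow_eq_one_iff F (q - 1)).mp fun x => by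
      ext
      rw [Units.val_pow_eq_pow_val, Units.val_one]
      refine mul_left_cancel₀ x.ne_zero ?_
      rw [← pow_succ', Nat.sub_add_cancel h1.le, h, mul_one]
    rw [hF] at this
    have := Nat.le_of_dvd (by omega) this
    nlinarith [Nat.sub_add_cancel h1.le, Nat.sub_add_cancel (Nat.one_le_pow 2 q (by omega))]
  let θ := g ^ q - g
  have hθ : θ ≠ 0 := sub_ne_zero.mpr hg
  have hθq : θ ^ q = -θ := by simp [θ, hsub, hinv]
  let φ : F ≃ fixedSubfield hodd hadd × fixedSubfield hodd hadd :=
    { toFun := fun x => (⟨x ^ q + x, by rw [mem_fixedSubfield, hadd, hinv, add_comm]⟩,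
        ⟨(x - x ^ q) / θ, by
          rw [mem_fixedSubfield, div_pow, hsub, hinv, hθq, div_neg, ← neg_div, neg_sub]⟩)
      invFun := fun y => (y.1 + θ * y.2) / 2
      left_inv := fun x => by
        simp only
        field_simp
        ring
      right_inv := fun ⟨⟨s, hs⟩, ⟨t, ht⟩⟩ => by
        rw [mem_fixedSubfield] at hs ht
        ext
        · simp only [div_pow, hadd, mul_pow, hs, ht, hθq, h2q]
          field_simp
          ring
        · simp only [div_pow, hadd, mul_pow, hs, ht, hθq, h2q]
          field_simp
          ring }
  have h := Nat.card_congr φ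
  rw [Nat.card_prod, Nat.card_eq_fintype_card, hF, ← sq] at h
  exact (Nat.pow_left_injective two_ne_zero h).symm

/-- If the matrix `!![2 * a, c; c, 2 * b]` has determinant zero or not a square, then the solutions
of `A u = u ^ q` span at most a line over the fixed field. -/
theorem not_linearIndependent_of_mul_eq_pow {a b c x₁ y₁ x₂ y₂ : F}
    (hΔ : ¬ IsSquare (4 * a * b - c ^ 2) ∨ 4 * a * b - c ^ 2 = 0)
    (hx₁ : 2 * a * x₁ + c * y₁ = x₁ ^ q) (hy₁ : c * x₁ + 2 * b * y₁ = y₁ ^ q)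
    (hx₂ : 2 * a * x₂ + c * y₂ = x₂ ^ q) (hy₂ : c * x₂ + 2 * b * y₂ = y₂ ^ q) :
    ¬ LinearIndependent (fixedSubfield hodd hadd) ![(x₁, y₁), (x₂, y₂)] := by
  intro hli
  have hsub : ∀ x y : F, (x - y) ^ q = x ^ q - y ^ q := fun x y => by
    rw [sub_eq_add_neg, hadd, hodd.neg_pow, sub_eq_add_neg]
  have hD : (4 * a * b - c ^ 2) * (x₁ * y₂ - x₂ * y₁) = (x₁ * y₂ - x₂ * y₁) ^ q := by
    rw [hsub, mul_pow, mul_pow, ← hx₁, ← hx₂, ← hy₁, ← hy₂]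
    ring
  by_cases h0 : x₁ * y₂ - x₂ * y₁ = 0
  · have hne : (x₁, y₁) ≠ 0 := hli.ne_zero 0
    obtain ⟨r, hr₁, hr₂⟩ : ∃ r, x₂ = r * x₁ ∧ y₂ = r * y₁ := by
      by_cases hx : x₁ = 0
      · have hy : y₁ ≠ 0 := fun hy => hne (by simp [hx, hy])
        have : x₂ = 0 := by simpa [hx, hy] using h0
        exact ⟨y₂ / y₁, by simp [this, hx], by field_simp⟩
      · exact ⟨x₂ / x₁, by field_simp, by field_simp; linear_combination h0⟩
    have hr : r ^ q = r := by
      subst hr₁ hr₂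
      rw [mul_pow] at hx₂ hy₂
      by_cases hx : x₁ = 0
      · have hy : y₁ ≠ 0 := fun hy => hne (by simp [hx, hy])
        refine mul_right_cancel₀ (pow_ne_zero q hy) ?_
        linear_combination r * hy₁ - hy₂
      · refine mul_right_cancel₀ (pow_ne_zero q hx) ?_
        linear_combination r * hx₁ - hx₂
    have := LinearIndependent.pair_iff.mp hli ⟨r, hr⟩ (-1) (by
      simp [Subfield.smul_def, hr₁, hr₂])
    simp at this
  · rcases hΔ with hΔ | hΔ
    · obtain ⟨m, rfl⟩ := hodd
      refine hΔ ⟨(x₁ * y₂ - x₂ * y₁) ^ m, ?_⟩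
      refine mul_right_cancel₀ h0 ?_
      rw [hD]
      ring
    · rw [hΔ, zero_mul] at hD
      exact pow_ne_zero q h0 hD.symm

end Conjugation

theorem affine_intersection_sizes_elliptic_or_cone
    (q : ℕ) (hq : ∃ p n : ℕ, p.Prime ∧ Odd p ∧ 0 < n ∧ q = p ^ n)
    (F : Type) [Field F] [Fintype F] (hF : Fintype.card F = q ^ 2)
    (a b c d e f : F)
    (hQ : ¬ IsSquare (4 * a * b - c ^ 2) ∨
      (4 * a * b - c ^ 2 = 0 ∧ ¬ (a = 0 ∧ b = 0 ∧ c = 0))) :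
    Nat.card {v : F × F × F //
        v.2.2 ^ q + v.2.2 = v.1 ^ (q + 1) + v.2.1 ^ (q + 1) ∧
        v.2.2 = a * v.1 ^ 2 + b * v.2.1 ^ 2 + c * v.1 * v.2.1 +
          d * v.1 + e * v.2.1 + f} ∈
      ({q ^ 3 - q ^ 2, q ^ 3 - q ^ 2 + q, q ^ 3 - q, q ^ 3, q ^ 3 + q,
        q ^ 3 + q ^ 2 - q, q ^ 3 + q ^ 2} : Set ℕ) := by
  obtain ⟨p, n, hp, hpodd, hn, hqp⟩ := hq
  have hodd : Odd q := hqp ▸ hpodd.pow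
  have h1 : 1 < q := hqp ▸ Nat.one_lt_pow hn.ne' hp.one_lt
  have := Fact.mk hp
  have hchar : CharP F p := charP_of_card_eq_prime_pow (f := n * 2) (by rw [hF, hqp, pow_mul])
  have hadd : ∀ x y : F, (x + y) ^ q = x ^ q + y ^ q := fun x y => by
    rw [hqp, add_pow_char_pow]
  have hinv : ∀ x : F, (x ^ q) ^ q = x := fun x => by
    rw [← pow_mul, ← sq, ← hF, FiniteField.pow_card]
  have h2 : (2 : F) ≠ 0 := by
    refine Ring.two_ne_zero ?_
    rw [ringChar.eq F p]
    rintro rfl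
    exact absurd hpodd (by decide)
  have h2q : (2 : F) ^ q = 2 := by
    rw [← one_add_one_eq_two, hadd, one_pow]
  let K := fixedSubfield hodd hadd
  have hK : Nat.card K = q := card_fixedSubfield hodd hadd h2 h1 hF
  have := Fintype.ofFinite K
  have h2K : ringChar K ≠ 2 := by
    intro h
    refine h2 (congrArg Subtype.val (?_ : (2 : K) = 0))
    have := ringChar.Nat.cast_ringChar (R := K)
    rwa [h] at this
  have hfin : Module.finrank K F = 2 := by
    have h := Module.card_eq_pow_finrank (K := K) (V := F)
    rw [hF, ← Nat.card_eq_fintype_card, hK] at h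
    exact (Nat.pow_right_injective h1 h).symm
  have hV : Module.finrank K (F × F) = 4 := by
    rw [Module.finrank_prod, hfin]
  let T := fixedTrace hodd hadd hinv
  have hT : ∀ x, (T x : F) = x ^ q + x := coe_fixedTrace hodd hadd hinv
  let B : LinearMap.BilinMap K (F × F) K := LinearMap.mk₂ K
    (fun u v => T (a * u.1 * v.1 + b * u.2 * v.2 + c * u.1 * v.2 -
      2⁻¹ * (u.1 ^ q * v.1 + u.2 ^ q * v.2)))
    (fun u u' v => by
      rw [← map_add]
      refine congrArg T ?_
      simp only [Prod.fst_add, Prod.snd_add, hadd]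
      ring)
    (fun k u v => by
      have hk : (k : F) ^ q = k := k.2
      rw [← map_smul]
      refine congrArg T ?_
      simp only [Prod.smul_fst, Prod.smul_snd, Subfield.smul_def, smul_eq_mul, mul_pow, hk]
      ring)
    (fun u v v' => by
      rw [← map_add]
      refine congrArg T ?_
      simp only [Prod.fst_add, Prod.snd_add]
      ring)
    (fun k u v => by
      rw [← map_smul]
      refine congrArg T ?_
      simp only [Prod.smul_fst, Prod.smul_snd, Subfield.smul_def, smul_eq_mul]
      ring)
  have hB : ∀ u v, B u v = T (a * u.1 * v.1 + b * u.2 * v.2 + c * u.1 * v.2 -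
      2⁻¹ * (u.1 ^ q * v.1 + u.2 ^ q * v.2)) := fun u v => rfl
  let L : F × F →ₗ[K] K :=
    { toFun := fun u => T (d * u.1 + e * u.2)
      map_add' := fun u v => by
        rw [← map_add]
        refine congrArg T ?_
        simp only [Prod.fst_add, Prod.snd_add]
        ring
      map_smul' := fun k u => by
        rw [RingHom.id_apply, ← map_smul]
        refine congrArg T ?_
        simp only [Prod.smul_fst, Prod.smul_snd, Subfield.smul_def, smul_eq_mul]
        ring }
  have hL : ∀ u, L u = T (d * u.1 + e * u.2) := fun u => rfl
  have hpolar : ∀ u v, QuadraticMap.polar B.toQuadraticMap u v =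
      T ((2 * a * u.1 + c * u.2 - u.1 ^ q) * v.1 + (c * u.1 + 2 * b * u.2 - u.2 ^ q) * v.2) := by
    intro u v
    rw [LinearMap.BilinMap.polar_toQuadraticMap]
    ext
    simp only [hB, Subfield.coe_add, hT, sub_eq_add_neg, hadd, mul_pow, hodd.neg_pow, hinv, inv_pow, h2q]
    field_simp
    ring
  have hrad : ∀ u, (∀ v, QuadraticMap.polar B.toQuadraticMap u v = 0) →
      2 * a * u.1 + c * u.2 = u.1 ^ q ∧ c * u.1 + 2 * b * u.2 = u.2 ^ q := by
    intro u hu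
    have hT1 : T 1 ≠ 0 := fun h => h2 (by
      have := congrArg Subtype.val h
      rwa [hT, one_pow, one_add_one_eq_two] at this)
    constructor <;> rw [← sub_eq_zero] <;> by_contra h
    · have := hu ((2 * a * u.1 + c * u.2 - u.1 ^ q)⁻¹, 0)
      rw [hpolar, mul_inv_cancel₀ h, mul_zero, add_zero] at this
      exact hT1 this
    · have := hu (0, (c * u.1 + 2 * b * u.2 - u.2 ^ q)⁻¹)
      rw [hpolar, mul_inv_cancel₀ h, mul_zero, zero_add] at this
      exact hT1 this
  have hcount := fiberCard_quadraticForm_mem h2K hV B.toQuadraticMap L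
    (fun u v hu hv => not_linearIndependent_of_mul_eq_pow hodd hadd (hQ.imp_right And.left)
      (hrad u hu).1 (hrad u hu).2 (hrad v hv).1 (hrad v hv).2) (-T f) (q := q)
    (by rw [← hK, Nat.card_eq_fintype_card])
  let φ : {v : F × F × F //
        v.2.2 ^ q + v.2.2 = v.1 ^ (q + 1) + v.2.1 ^ (q + 1) ∧
        v.2.2 = a * v.1 ^ 2 + b * v.2.1 ^ 2 + c * v.1 * v.2.1 +
          d * v.1 + e * v.2.1 + f} ≃ {u : F × F // B.toQuadraticMap u + L u = -T f} :=
    have key : ∀ x y : F, B.toQuadraticMap (x, y) + L (x, y) = -T f ↔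
        (a * x ^ 2 + b * y ^ 2 + c * x * y + d * x + e * y + f) ^ q +
          (a * x ^ 2 + b * y ^ 2 + c * x * y + d * x + e * y + f) =
            x ^ (q + 1) + y ^ (q + 1) := by
      intro x y
      rw [LinearMap.BilinMap.toQuadraticMap_apply, hB, hL, ← map_add, ← add_eq_zero_iff_eq_neg,
        ← map_add, ← sub_eq_zero (b := x ^ (q + 1) + y ^ (q + 1)), ← ZeroMemClass.coe_eq_zero, hT]
      refine Eq.congr ?_ rfl
      simp only [sub_eq_add_neg, hadd, mul_pow, hodd.neg_pow, hinv, inv_pow, h2q]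
      field_simp
      ring
    { toFun := fun v => ⟨(v.1.1, v.1.2.1), (key _ _).mpr (by rw [← v.2.2, v.2.1])⟩
      invFun := fun u => ⟨(u.1.1, u.1.2, a * u.1.1 ^ 2 + b * u.1.2 ^ 2 + c * u.1.1 * u.1.2 +
          d * u.1.1 + e * u.1.2 + f), (key _ _).mp u.2, rfl⟩
      left_inv := fun ⟨⟨x, y, z⟩, h⟩ => by
        simp only [Subtype.mk.injEq, Prod.mk.injEq, true_and]
        exact h.2.symm
      right_inv := fun u => rfl }
  rw [Nat.card_congr φ]
  rw [fiberCard] at hcount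
  have hle₁ : q ^ 2 ≤ q ^ 3 := Nat.pow_le_pow_right hodd.pos (by norm_num)
  have hle₂ : q ≤ q ^ 2 := Nat.le_self_pow two_ne_zero q
  simp only [Set.mem_insert_iff, Set.mem_singleton_iff] at hcount ⊢
  zify [hle₁, hle₂.trans hle₁, hle₂.trans (Nat.le_add_left (q ^ 2) (q ^ 3))]
  exact hcount
end
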